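/- For every p_0 < 1 there exists a constant K such that the following holds. Suppose 0 < p ≤ p_0 and 0 ≤ q ≤ p, let Y ~ Ber(q), and let X := Y·log(q/p) + (1−Y)·log((1−q)/(1−p)) (interpreted as X := 0 when q = 0 and Y = 1, an event of probability zero). Then Var(X) ≤ K·E[X] = K·i_p(q). -/

import Mathlib

/-- The relative entropy `i_p(q) = D_KL(Ber(q) ‖ Ber(p))`.  (In Lean `Real.log 0 = 0`,
which implements the convention `0 · log 0 = 0`.) -/
noncomputable def ip (p q : ℝ) : ℝ :=
  q * Real.log (q / p) + (1 - q) * Real.log ((1 - q) / (1 - p))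

theorem sq_sqrt_sub_one_le {t : ℝ} (ht : 0 ≤ t) :
    (√t - 1) ^ 2 ≤ t * Real.log t - t + 1 := by
  obtain ⟨r, hr, rfl⟩ : ∃ r : ℝ, 0 ≤ r ∧ t = r ^ 2 :=
    ⟨√t, Real.sqrt_nonneg t, (Real.sq_sqrt ht).symm⟩
  rw [Real.sqrt_sq hr, Real.log_pow]
  push_cast
  rcases hr.eq_or_lt with rfl | hr
  · simp
  have h := mul_le_mul_of_nonneg_left (Real.one_sub_inv_le_log_of_pos hr) (sq_nonneg r)
  have hinv : r ^ 2 * (1 - r⁻¹) = r ^ 2 - r := by field_simp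
  linarith

theorem mul_log_sq_le_of_le_one {t : ℝ} (ht : 0 ≤ t) (ht₁ : t ≤ 1) :
    t * Real.log t ^ 2 ≤ 4 * (t * Real.log t - t + 1) := by
  refine le_trans ?_ (mul_le_mul_of_nonneg_left (sq_sqrt_sub_one_le ht) (by norm_num))
  obtain ⟨r, hr, rfl⟩ : ∃ r : ℝ, 0 ≤ r ∧ t = r ^ 2 :=
    ⟨√t, Real.sqrt_nonneg t, (Real.sq_sqrt ht).symm⟩
  rw [Real.sqrt_sq hr, Real.log_pow]
  push_cast
  rcases hr.eq_or_lt with rfl | hr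
  · simp
  have hr₁ : r ≤ 1 := by nlinarith
  have hlog := Real.log_nonpos hr.le hr₁
  have h := mul_le_mul_of_nonneg_left (Real.one_sub_inv_le_log_of_pos hr) hr.le
  have hinv : r * (1 - r⁻¹) = r - 1 := by field_simp
  have hnonpos : r * Real.log r ≤ 0 := mul_nonpos_of_nonneg_of_nonpos hr.le hlog
  nlinarith

theorem log_sq_le_of_one_le {s : ℝ} (hs : 1 ≤ s) :
    Real.log s ^ 2 ≤ 4 * (s * Real.log s - s + 1) := by
  have hs₀ : 0 ≤ s := zero_le_one.trans hs
  refine le_trans ?_ (mul_le_mul_of_nonneg_left (sq_sqrt_sub_one_le hs₀) (by norm_num))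
  have hr : 1 ≤ √s := Real.one_le_sqrt.2 hs
  have hlog := Real.log_le_sub_one_of_pos (zero_lt_one.trans_le hr)
  rw [Real.log_sqrt hs₀] at hlog
  nlinarith [Real.log_nonneg hs]

theorem ip_eq_add {p q : ℝ} (hp : p ≠ 0) (hp₁ : 1 - p ≠ 0) :
    ip p q = p * (q / p * Real.log (q / p) - q / p + 1) +
      (1 - p) * ((1 - q) / (1 - p) * Real.log ((1 - q) / (1 - p)) - (1 - q) / (1 - p) + 1) := by
  unfold ip
  generalize Real.log (q / p) = a
  generalize Real.log ((1 - q) / (1 - p)) = b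
  field_simp
  ring

/-- Lemma `lem:calc Var`: for every `p₀ < 1` there is a constant `K` such that for all
`0 < p ≤ p₀` and `0 ≤ q ≤ p`, the random variable
`X = Y·log(q/p) + (1−Y)·log((1−q)/(1−p))` (with `Y ~ Ber(q)`) satisfies
`Var(X) ≤ K · E[X] = K · i_p(q)`.  Here `E[X] = i_p q` and
`Var(X) = E[X²] − (E[X])²` with `E[X²] = q·log(q/p)² + (1−q)·log((1−q)/(1−p))²`;
the degenerate value of `X` on the probability-zero event `{q = 0, Y = 1}` contributes `0`
since `Real.log 0 = 0`. -/
theorem var_le_const_mul_mean (p₀ : ℝ) (hp₀ : p₀ < 1) :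
    ∃ K : ℝ, ∀ p q : ℝ, 0 < p → p ≤ p₀ → 0 ≤ q → q ≤ p →
      (q * (Real.log (q / p)) ^ 2 + (1 - q) * (Real.log ((1 - q) / (1 - p))) ^ 2)
          - (ip p q) ^ 2
        ≤ K * ip p q := by
  refine ⟨4 / (1 - p₀), fun p q hp hpp₀ hq hqp => ?_⟩
  have hp₁ : 0 < 1 - p := by linarith
  have hp₀' : 0 < 1 - p₀ := by linarith
  have ht := mul_log_sq_le_of_le_one (div_nonneg hq hp.le) ((div_le_one hp).2 hqp)
  have hs := log_sq_le_of_one_le ((one_le_div hp₁).2 (by linarith : 1 - p ≤ 1 - q))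
  have hA := (sq_nonneg _).trans (sq_sqrt_sub_one_le (div_nonneg hq hp.le))
  have hB := (sq_nonneg _).trans
    (sq_sqrt_sub_one_le (div_nonneg (by linarith : 0 ≤ 1 - q) hp₁.le))
  have hmean := ip_eq_add (q := q) hp.ne' hp₁.ne'
  set A := q / p * Real.log (q / p) - q / p + 1
  set B := (1 - q) / (1 - p) * Real.log ((1 - q) / (1 - p)) - (1 - q) / (1 - p) + 1
  have hfirst : q * Real.log (q / p) ^ 2 ≤ 4 / (1 - p₀) * (p * A) := by
    calc q * Real.log (q / p) ^ 2 = p * (q / p * Real.log (q / p) ^ 2) := by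
          rw [← mul_assoc, mul_div_cancel₀ _ hp.ne']
      _ ≤ p * (4 * A) := by gcongr
      _ = 4 * (p * A) := by ring
      _ ≤ 4 / (1 - p₀) * (p * A) := by
          gcongr
          exact (le_div_iff₀ hp₀').2 (by linarith)
  have hsecond : (1 - q) * Real.log ((1 - q) / (1 - p)) ^ 2 ≤ 4 / (1 - p₀) * ((1 - p) * B) := by
    calc (1 - q) * Real.log ((1 - q) / (1 - p)) ^ 2
        ≤ 1 * (4 * B) := mul_le_mul (by linarith) hs (sq_nonneg _) zero_le_one
      _ = 4 / (1 - p₀) * ((1 - p₀) * B) := by field_simp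
      _ ≤ 4 / (1 - p₀) * ((1 - p) * B) := by gcongr
  rw [hmean, mul_add]
  nlinarith [sq_nonneg (p * A + (1 - p) * B)]
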